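/- The 580 × 580 matrix GS([A1], [A2], [A3], [A4]) built by substituting the circulant matrices [A1], [A2], [A3], [A4] into the Goethals–Seidel array is a skew-Hadamard matrix of order 580; that is, all its entries are ±1, it satisfies M · Mᵀ = 580 · I_580, and M + Mᵀ = 2 · I_580. -/

import Mathlib

open Finset Matrix

/-- The subgroup H of order 7 of the multiplicative group of `ZMod 145`. -/
def H : Finset (ZMod 145) := {1, 16, 36, 81, 111, 136, 141}

/-- Representatives of the even-indexed orbits. -/
def rep : List (ZMod 145) := [1, 2, 3, 6, 7, 11, 14, 22, 5, 10, 29, 58]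

/-- The orbits `α i`: `α (2*i) = rep[i] • H` and `α (2*i+1) = -α (2*i)`. -/
def alpha (i : ℕ) : Finset (ZMod 145) :=
  if i % 2 = 0 then H.image (fun h => rep.getD (i / 2) 0 * h)
  else (H.image (fun h => rep.getD (i / 2) 0 * h)).image (fun x => -x)

def A1 : Finset (ZMod 145) := ({1, 2, 4, 7, 9, 10, 13, 14, 16, 19, 20, 22} : Finset ℕ).biUnion alpha
def A2 : Finset (ZMod 145) := ({0, 2, 4, 7, 10, 11, 14, 18, 19, 20, 21, 22} : Finset ℕ).biUnion alpha
def A3 : Finset (ZMod 145) := ({1, 3, 6, 9, 12, 13, 14, 17, 19, 20, 21, 22, 23} : Finset ℕ).biUnion alpha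
def A4 : Finset (ZMod 145) := ({2, 3, 5, 6, 7, 9, 12, 13, 15, 16, 19, 20, 21, 22, 23} : Finset ℕ).biUnion alpha

/-- The circulant {±1}-matrix `[X]` associated to `X ⊆ ZMod 145`. -/
def circ (X : Finset (ZMod 145)) : Matrix (ZMod 145) (ZMod 145) ℤ :=
  Matrix.of fun i j => if j - i ∈ X then -1 else 1

/-- The back-diagonal permutation matrix `R`. -/
def R : Matrix (ZMod 145) (ZMod 145) ℤ :=
  Matrix.of fun i j => if i + j = (144 : ZMod 145) then 1 else 0

/-- The Goethals–Seidel array. -/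
def GS (P1 P2 P3 P4 : Matrix (ZMod 145) (ZMod 145) ℤ) :
    Matrix (Fin 4 × ZMod 145) (Fin 4 × ZMod 145) ℤ :=
  Matrix.of fun p q =>
    (![![P1, P2 * R, P3 * R, P4 * R],
       ![-(P2 * R), P1, -(P4ᵀ * R), P3ᵀ * R],
       ![-(P3 * R), P4ᵀ * R, P1, -(P2ᵀ * R)],
       ![-(P4 * R), -(P3ᵀ * R), P2ᵀ * R, P1]] p.1 q.1) p.2 q.2

/-- The function on `ZMod 145` taking the value `-1` where the binary digit of `m` is `1`, and `1`
elsewhere. -/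
def signVec (m : ℕ) (k : ZMod 145) : ℤ := if m.testBit k.val then -1 else 1

/-- The periodic autocorrelation of a function on `ZMod 145`. -/
def autocorr (s : ZMod 145 → ℤ) (d : ZMod 145) : ℤ := ∑ k, s k * s (k + d)

/-- The binary encoding of `A1`. -/
def mask1 : ℕ := 23579831101534759513072580534518622313392700

/-- The binary encoding of `A2`. -/
def mask2 : ℕ := 3823609839665890011129782742117883110984718

/-- The binary encoding of `A3`. -/
def mask3 : ℕ := 35242117700903372516339130846979766794085200

/-- The binary encoding of `A4`. -/
def mask4 : ℕ := 17993423883908222951078322874238521148600676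

theorem autocorr_neg (s : ZMod 145 → ℤ) (d : ZMod 145) : autocorr s (-d) = autocorr s d := by
  unfold autocorr
  rw [← Equiv.sum_comp (Equiv.addRight d)]
  simp [mul_comm]

theorem autocorr_sixteen_mul {s : ZMod 145 → ℤ} (hs : ∀ k, s (16 * k) = s k) (d : ZMod 145) :
    autocorr s (16 * d) = autocorr s d := by
  have hu : (16 : ZMod 145) * 136 = 1 := by decide
  unfold autocorr
  rw [← Equiv.sum_comp (Units.mulLeft ⟨16, 136, hu, by rw [mul_comm, hu]⟩)]
  simp [← mul_add, hs]

theorem autocorr_sixteen_pow_mul {s : ZMod 145 → ℤ} (hs : ∀ k, s (16 * k) = s k) (n : ℕ)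
    (d : ZMod 145) : autocorr s (16 ^ n * d) = autocorr s d := by
  induction n with
  | zero => simp
  | succ n ih => rw [pow_succ', mul_assoc, autocorr_sixteen_mul hs, ih]

theorem exists_eq_sixteen_pow_mul_rep : ∀ d : ZMod 145, d ≠ 0 →
    ∃ r ∈ rep, ∃ n < 7, d = 16 ^ n * r ∨ d = -(16 ^ n * r) := by
  decide +kernel

theorem autocorr_masks_rep : ∀ r ∈ rep,
    autocorr (signVec mask1) r + autocorr (signVec mask2) r + autocorr (signVec mask3) r +
      autocorr (signVec mask4) r = 0 := by
  decide +kernel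

theorem signVec_mul_self (m : ℕ) (k : ZMod 145) : signVec m k * signVec m k = 1 := by
  unfold signVec
  split_ifs <;> rfl

theorem autocorr_signVec_zero (m : ℕ) : autocorr (signVec m) 0 = 145 := by
  simp [autocorr, signVec_mul_self, ZMod.card]

theorem autocorr_masks (d : ZMod 145) :
    autocorr (signVec mask1) d + autocorr (signVec mask2) d + autocorr (signVec mask3) d +
      autocorr (signVec mask4) d = if d = 0 then 580 else 0 := by
  have h1 : ∀ k, signVec mask1 (16 * k) = signVec mask1 k := by decide +kernel
  have h2 : ∀ k, signVec mask2 (16 * k) = signVec mask2 k := by decide +kernel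
  have h3 : ∀ k, signVec mask3 (16 * k) = signVec mask3 k := by decide +kernel
  have h4 : ∀ k, signVec mask4 (16 * k) = signVec mask4 k := by decide +kernel
  split_ifs with hd
  · simp [hd, autocorr_signVec_zero]
  · obtain ⟨r, hr, n, -, rfl | rfl⟩ := exists_eq_sixteen_pow_mul_rep d hd <;>
    simp only [autocorr_neg, autocorr_sixteen_pow_mul h1, autocorr_sixteen_pow_mul h2,
      autocorr_sixteen_pow_mul h3, autocorr_sixteen_pow_mul h4, autocorr_masks_rep r hr]

theorem circ_eq_circulant {X : Finset (ZMod 145)} {m : ℕ}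
    (h : ∀ k : ZMod 145, k ∈ X ↔ m.testBit k.val = true) :
    circ X = circulant fun k => signVec m (-k) := by
  ext i j
  simp [circ, circulant_apply, signVec, h]

theorem circ_A1 : circ A1 = circulant fun k => signVec mask1 (-k) :=
  circ_eq_circulant (by decide +kernel)

theorem circ_A2 : circ A2 = circulant fun k => signVec mask2 (-k) :=
  circ_eq_circulant (by decide +kernel)

theorem circ_A3 : circ A3 = circulant fun k => signVec mask3 (-k) :=
  circ_eq_circulant (by decide +kernel)

theorem circ_A4 : circ A4 = circulant fun k => signVec mask4 (-k) :=
  circ_eq_circulant (by decide +kernel)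

theorem circulant_mul_transpose_apply (s : ZMod 145 → ℤ) (i j : ZMod 145) :
    ((circulant fun k => s (-k)) * (circulant fun k => s (-k))ᵀ) i j = autocorr s (i - j) := by
  rw [mul_apply, autocorr, ← Equiv.sum_comp (Equiv.addRight i)]
  simp [circulant_apply, add_sub_assoc]

theorem mul_R_apply (M : Matrix (ZMod 145) (ZMod 145) ℤ) (i j : ZMod 145) :
    (M * R) i j = M i (144 - j) := by
  simp [mul_apply, R, ← eq_sub_iff_add_eq]

theorem R_mul_apply (M : Matrix (ZMod 145) (ZMod 145) ℤ) (i j : ZMod 145) :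
    (R * M) i j = M (144 - i) j := by
  simp [mul_apply, R, ← eq_sub_iff_add_eq']

theorem R_mul_R : R * R = 1 := by
  ext i j
  rw [mul_R_apply]
  simp [R, one_apply, add_sub_left_comm, sub_eq_zero]

theorem R_transpose : Rᵀ = R := by
  ext i j
  simp [R, add_comm]

theorem R_mul_circulant (v : ZMod 145 → ℤ) :
    R * circulant v = (circulant fun k => v (-k)) * R := by
  ext i j
  rw [R_mul_apply, mul_R_apply, circulant_apply, circulant_apply]
  congr 1
  ring

theorem mul_R_mul_R (M : Matrix (ZMod 145) (ZMod 145) ℤ) : M * R * R = M := by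
  rw [mul_assoc, R_mul_R, mul_one]

theorem mul_R_mul_circulant (M : Matrix (ZMod 145) (ZMod 145) ℤ) (v : ZMod 145 → ℤ) :
    M * R * circulant v = (M * circulant fun k => v (-k)) * R := by
  rw [mul_assoc, R_mul_circulant, mul_assoc]

theorem GS_mul_transpose (v1 v2 v3 v4 : ZMod 145 → ℤ) (n : ℤ)
    (h : circulant v1 * (circulant v1)ᵀ + circulant v2 * (circulant v2)ᵀ +
      circulant v3 * (circulant v3)ᵀ + circulant v4 * (circulant v4)ᵀ = n • 1) :
    GS (circulant v1) (circulant v2) (circulant v3) (circulant v4) *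
      (GS (circulant v1) (circulant v2) (circulant v3) (circulant v4))ᵀ = n • 1 := by
  have key : ∀ (B : Fin 4 → Fin 4 → Matrix (ZMod 145) (ZMod 145) ℤ),
      (∀ a b, ∑ c, B a c * (B b c)ᵀ = if a = b then n • 1 else 0) →
      (Matrix.of fun p q : Fin 4 × ZMod 145 => B p.1 q.1 p.2 q.2) *
        (Matrix.of fun p q : Fin 4 × ZMod 145 => B p.1 q.1 p.2 q.2)ᵀ = n • 1 := by
    intro B hB
    ext ⟨a, i⟩ ⟨b, j⟩
    have hab := congrFun (congrFun (hB a b) i) j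
    simp only [Matrix.sum_apply, mul_apply, transpose_apply] at hab
    simp only [mul_apply, transpose_apply, of_apply, Fintype.sum_prod_type, hab]
    by_cases hab' : a = b <;> simp [hab', one_apply]
  apply key
  simp only [transpose_circulant] at h
  intro a b
  fin_cases a <;> fin_cases b <;>
    simp [Fin.sum_univ_four, transpose_mul, R_transpose, transpose_circulant, ← mul_assoc,
      R_mul_circulant, mul_R_mul_circulant, mul_R_mul_R, ← h, circulant_mul_comm] <;>
    abel

theorem GS_add_transpose (v1 v2 v3 v4 : ZMod 145 → ℤ)
    (h : circulant v1 + (circulant v1)ᵀ = (2 : ℤ) • 1) :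
    GS (circulant v1) (circulant v2) (circulant v3) (circulant v4) +
      (GS (circulant v1) (circulant v2) (circulant v3) (circulant v4))ᵀ = (2 : ℤ) • 1 := by
  have key : ∀ (B : Fin 4 → Fin 4 → Matrix (ZMod 145) (ZMod 145) ℤ),
      (∀ a b, B a b + (B b a)ᵀ = if a = b then (2 : ℤ) • 1 else 0) →
      (Matrix.of fun p q : Fin 4 × ZMod 145 => B p.1 q.1 p.2 q.2) +
        (Matrix.of fun p q : Fin 4 × ZMod 145 => B p.1 q.1 p.2 q.2)ᵀ = (2 : ℤ) • 1 := by
    intro B hB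
    ext ⟨a, i⟩ ⟨b, j⟩
    have hab := congrFun (congrFun (hB a b) i) j
    simp only [Matrix.add_apply, transpose_apply] at hab
    simp only [Matrix.add_apply, transpose_apply, of_apply, hab]
    by_cases hab' : a = b <;> simp [hab', one_apply]
  apply key
  simp only [transpose_circulant] at h
  intro a b
  fin_cases a <;> fin_cases b <;>
    simp [transpose_mul, R_transpose, transpose_circulant, R_mul_circulant, h]

theorem GS_apply_eq_one_or (P1 P2 P3 P4 : Matrix (ZMod 145) (ZMod 145) ℤ)
    (h1 : ∀ i j, P1 i j = 1 ∨ P1 i j = -1) (h2 : ∀ i j, P2 i j = 1 ∨ P2 i j = -1)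
    (h3 : ∀ i j, P3 i j = 1 ∨ P3 i j = -1) (h4 : ∀ i j, P4 i j = 1 ∨ P4 i j = -1)
    (p q : Fin 4 × ZMod 145) : GS P1 P2 P3 P4 p q = 1 ∨ GS P1 P2 P3 P4 p q = -1 := by
  have mulR {M : Matrix (ZMod 145) (ZMod 145) ℤ} (h : ∀ i j, M i j = 1 ∨ M i j = -1) (i j) :
      (M * R) i j = 1 ∨ (M * R) i j = -1 := by
    rw [mul_R_apply]
    exact h _ _
  have neg {M : Matrix (ZMod 145) (ZMod 145) ℤ} (h : ∀ i j, M i j = 1 ∨ M i j = -1) (i j) :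
      (-M) i j = 1 ∨ (-M) i j = -1 := by
    rw [Matrix.neg_apply, neg_inj, neg_eq_iff_eq_neg]
    exact (h i j).symm
  have tr {M : Matrix (ZMod 145) (ZMod 145) ℤ} (h : ∀ i j, M i j = 1 ∨ M i j = -1) (i j) :
      Mᵀ i j = 1 ∨ Mᵀ i j = -1 := h j i
  obtain ⟨a, i⟩ := p
  obtain ⟨b, j⟩ := q
  fin_cases a <;> fin_cases b
  · exact h1 i j
  · exact mulR h2 i j
  · exact mulR h3 i j
  · exact mulR h4 i j
  · exact neg (mulR h2) i j
  · exact h1 i j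
  · exact neg (mulR (tr h4)) i j
  · exact mulR (tr h3) i j
  · exact neg (mulR h3) i j
  · exact mulR (tr h4) i j
  · exact h1 i j
  · exact neg (mulR (tr h2)) i j
  · exact neg (mulR h4) i j
  · exact neg (mulR (tr h3)) i j
  · exact mulR (tr h2) i j
  · exact h1 i j

theorem circ_apply_eq_one_or (X : Finset (ZMod 145)) (i j : ZMod 145) :
    circ X i j = 1 ∨ circ X i j = -1 := by
  simp only [circ, of_apply]
  split_ifs <;> simp

theorem gs_skew_hadamard_A :
    (∀ p q, GS (circ A1) (circ A2) (circ A3) (circ A4) p q = 1 ∨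
            GS (circ A1) (circ A2) (circ A3) (circ A4) p q = -1) ∧
    GS (circ A1) (circ A2) (circ A3) (circ A4) *
      (GS (circ A1) (circ A2) (circ A3) (circ A4))ᵀ = (580 : ℤ) • 1 ∧
    GS (circ A1) (circ A2) (circ A3) (circ A4) +
      (GS (circ A1) (circ A2) (circ A3) (circ A4))ᵀ = (2 : ℤ) • 1 := by
  refine ⟨GS_apply_eq_one_or _ _ _ _ (circ_apply_eq_one_or _) (circ_apply_eq_one_or _)
    (circ_apply_eq_one_or _) (circ_apply_eq_one_or _), ?_⟩
  rw [circ_A1, circ_A2, circ_A3, circ_A4]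
  constructor
  · apply GS_mul_transpose
    ext i j
    simp only [Matrix.add_apply, circulant_mul_transpose_apply, autocorr_masks]
    simp [one_apply, sub_eq_zero]
  · apply GS_add_transpose
    have h : ∀ k, signVec mask1 (-k) + signVec mask1 k = if k = 0 then 2 else 0 := by
      decide +kernel
    ext i j
    simpa [circulant_apply, one_apply, sub_eq_zero] using h (i - j)
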